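/- Let a ∈ ℝ, b ≠ 0, ε > 0 and let u be the lump solution u(x,y,t) = 24 (−X²/ε² + 3 b² Y²/ε² + 1/b²)/(X²/ε² + 3 b² Y²/ε² + 1/b²)² with X = x + a y + (a² − 3b²) t and Y = y + 2 a t. Then for every fixed t, u(x,y,t) ≤ 24 b² for all (x,y) ∈ ℝ², and equality holds at the point x = (3 b² + a²) t, y = −2 a t. -/

import Mathlib

/-- The KPI lump solution with parameters `a`, `b`, `ε`. -/
noncomputable def lump (a b ε x y t : ℝ) : ℝ :=
  24 * (-(x + a * y + (a ^ 2 - 3 * b ^ 2) * t) ^ 2 / ε ^ 2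
          + 3 * b ^ 2 * (y + 2 * a * t) ^ 2 / ε ^ 2 + 1 / b ^ 2) /
    ((x + a * y + (a ^ 2 - 3 * b ^ 2) * t) ^ 2 / ε ^ 2
          + 3 * b ^ 2 * (y + 2 * a * t) ^ 2 / ε ^ 2 + 1 / b ^ 2) ^ 2

/-- For every fixed `t`, the lump is bounded above by `24 b²`, and this maximum
value is attained at `x = (3b² + a²) t`, `y = −2 a t`. -/
theorem lump_max (a b ε : ℝ) (hb : b ≠ 0) (hε : 0 < ε) (t : ℝ) :
    (∀ x y : ℝ, lump a b ε x y t ≤ 24 * b ^ 2) ∧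
      lump a b ε ((3 * b ^ 2 + a ^ 2) * t) (-(2 * a * t)) t = 24 * b ^ 2 := by
  have hb2 : 0 < b ^ 2 := by positivity
  refine ⟨fun x y => ?_, ?_⟩
  · unfold lump
    rw [neg_div]
    set P := (x + a * y + (a ^ 2 - 3 * b ^ 2) * t) ^ 2 / ε ^ 2
    set Q := 3 * b ^ 2 * (y + 2 * a * t) ^ 2 / ε ^ 2
    have hP : 0 ≤ P := by positivity
    have hQ : 0 ≤ Q := by positivity
    have hc : 0 < 1 / b ^ 2 := by positivity
    have hD : 1 ≤ b ^ 2 * (P + Q + 1 / b ^ 2) := by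
      have h : b ^ 2 * (1 / b ^ 2) = 1 := mul_one_div_cancel hb2.ne'
      nlinarith [mul_nonneg hb2.le (add_nonneg hP hQ)]
    rw [div_le_iff₀ (by positivity)]
    calc 24 * (-P + Q + 1 / b ^ 2) ≤ 24 * (1 * (P + Q + 1 / b ^ 2)) := by linarith
      _ ≤ 24 * (b ^ 2 * (P + Q + 1 / b ^ 2) * (P + Q + 1 / b ^ 2)) := by gcongr
      _ = 24 * b ^ 2 * (P + Q + 1 / b ^ 2) ^ 2 := by ring
  · have hX : (3 * b ^ 2 + a ^ 2) * t + a * -(2 * a * t) + (a ^ 2 - 3 * b ^ 2) * t = 0 := by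
      ring
    have hY : -(2 * a * t) + 2 * a * t = 0 := by ring
    unfold lump
    rw [hX, hY]
    simp only [ne_eq, OfNat.ofNat_ne_zero, not_false_eq_true, zero_pow, neg_zero, mul_zero, zero_div,
      zero_add]
    field_simp
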